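/- arXiv:1207.0598 — 2 statements merged into one kernel-verified Lean document; each statement's English description precedes it below -/
import Mathlib

section
/- Let λ be a real number with λ < 0. Then the series Z(x) = ∑_{n≥0} e^{n(n-1)λ/2}/(n!·λⁿ) · xⁿ converges absolutely for every x ∈ ℂ, so Z defines an entire function on ℂ, and this function satisfies λ·x·Z′(x) = x·Z(e^λ·x) for all x ∈ ℂ. -/
/-- Termwise differentiation of an everywhere convergent complex power series. -/
theorem hasDerivAt_tsum_pow_of_summable (a : ℕ → ℂ)
    (ha : ∀ x : ℂ, Summable fun n : ℕ => ‖((n : ℂ) + 1) * a (n + 1) * x ^ n‖) (x : ℂ) :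
    HasDerivAt (fun y => ∑' n, a n * y ^ n) (∑' n : ℕ, ((n : ℂ) + 1) * a (n + 1) * x ^ n) x := by
  set R : ℝ := ‖x‖ + 1
  have hR : 0 < R := by positivity
  have hu : Summable fun n : ℕ => ‖a n * (n * (R : ℂ) ^ (n - 1))‖ := by
    rw [← summable_nat_add_iff 1]
    refine (ha R).congr fun n => ?_
    push_cast
    congr 1
    ring
  have hbound (n : ℕ) (y : ℂ) (hy : y ∈ Metric.ball (0 : ℂ) R) :
      ‖a n * (n * y ^ (n - 1))‖ ≤ ‖a n * (n * (R : ℂ) ^ (n - 1))‖ := by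
    have hy' : ‖y‖ ≤ R := (mem_ball_zero_iff.mp hy).le
    simp only [norm_mul, norm_pow, Complex.norm_real, Real.norm_of_nonneg hR.le]
    gcongr
  have hx : x ∈ Metric.ball (0 : ℂ) R := mem_ball_zero_iff.mpr (lt_add_one _)
  have h := hasDerivAt_tsum_of_isPreconnected hu Metric.isOpen_ball
    (convex_ball (0 : ℂ) R).isPreconnected
    (fun n y _ => (hasDerivAt_pow n y).const_mul (a n)) hbound
    (Metric.mem_ball_self hR)
    (summable_of_ne_finset_zero (s := {0}) fun n hn => by
      simp [zero_pow (Finset.notMem_singleton.mp hn)]) hx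
  rw [(Summable.of_norm_bounded hu fun n => hbound n x hx).tsum_eq_zero_add] at h
  refine h.congr_deriv ?_
  simp only [Nat.cast_zero, zero_mul, mul_zero, zero_add, Nat.add_sub_cancel]
  refine tsum_congr fun n => ?_
  push_cast
  ring

/-- The coefficient `e^{n(n-1)λ/2}/(n!·λⁿ)` of the Hurwitz partition function. -/
noncomputable def hurwitzCoeff (lam : ℝ) (n : ℕ) : ℂ :=
  Complex.exp ((n : ℂ) * ((n : ℂ) - 1) * (lam : ℂ) / 2) / ((n.factorial : ℂ) * (lam : ℂ) ^ n)

theorem hurwitzCoeff_succ {lam : ℝ} (hlam : lam ≠ 0) (n : ℕ) :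
    ((n : ℂ) + 1) * hurwitzCoeff lam (n + 1) =
      (lam : ℂ)⁻¹ * (hurwitzCoeff lam n * Complex.exp lam ^ n) := by
  have hl : (lam : ℂ) ≠ 0 := Complex.ofReal_ne_zero.mpr hlam
  have hn : (n : ℂ) + 1 ≠ 0 := Nat.cast_add_one_ne_zero n
  have hf : (n.factorial : ℂ) ≠ 0 := Nat.cast_ne_zero.mpr n.factorial_ne_zero
  have he : Complex.exp (((n + 1 : ℕ) : ℂ) * (((n + 1 : ℕ) : ℂ) - 1) * lam / 2) =
      Complex.exp ((n : ℂ) * ((n : ℂ) - 1) * lam / 2) * Complex.exp lam ^ n := by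
    rw [← Complex.exp_nat_mul, ← Complex.exp_add]
    congr 1
    push_cast
    ring
  rw [hurwitzCoeff, hurwitzCoeff, he, Nat.factorial_succ]
  push_cast
  field_simp
  ring

theorem norm_hurwitzCoeff_le {lam : ℝ} (hlam : lam ≤ 0) (n : ℕ) :
    ‖hurwitzCoeff lam n‖ ≤ 1 / (n.factorial * |lam| ^ n) := by
  have hn : (0 : ℝ) ≤ n * ((n : ℝ) - 1) := by
    rcases n with _ | n
    · simp
    · push_cast
      rw [add_sub_cancel_right]
      positivity
  have he : ‖Complex.exp ((n : ℂ) * ((n : ℂ) - 1) * (lam : ℂ) / 2)‖ ≤ 1 := by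
    have hc : (n : ℂ) * ((n : ℂ) - 1) * (lam : ℂ) / 2 =
        ((n * ((n : ℝ) - 1) * lam / 2 : ℝ) : ℂ) := by
      push_cast
      rfl
    rw [hc, Complex.norm_exp_ofReal, Real.exp_le_one_iff]
    linarith [mul_nonpos_of_nonneg_of_nonpos hn hlam]
  rw [hurwitzCoeff, norm_div, norm_mul, norm_pow, Complex.norm_natCast, Complex.norm_real,
    Real.norm_eq_abs]
  gcongr

theorem summable_norm_hurwitzCoeff_mul_pow {lam : ℝ} (hlam : lam ≤ 0) (x : ℂ) :
    Summable fun n : ℕ => ‖hurwitzCoeff lam n * x ^ n‖ := by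
  refine (Real.summable_pow_div_factorial (‖x‖ / |lam|)).of_nonneg_of_le
    (fun n => norm_nonneg _) fun n => ?_
  rw [norm_mul, norm_pow]
  calc ‖hurwitzCoeff lam n‖ * ‖x‖ ^ n
      ≤ 1 / (n.factorial * |lam| ^ n) * ‖x‖ ^ n := by
        gcongr
        exact norm_hurwitzCoeff_le hlam n
    _ = (‖x‖ / |lam|) ^ n / n.factorial := by
        rw [div_pow, div_div, mul_comm (|lam| ^ n), one_div_mul_eq_div]


/-- For real `λ < 0`, the Hurwitz partition function
`Z(x) = ∑_{n≥0} e^{n(n-1)λ/2}/(n!·λⁿ) · xⁿ` converges absolutely for every `x ∈ ℂ`,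
defines an entire function, and satisfies the quantum Lambert curve equation
`λ·x·Z′(x) = x·Z(e^λ·x)`. -/
theorem quantum_lambert_curve_analytic (lam : ℝ) (hlam : lam < 0) (Z : ℂ → ℂ)
    (hZ : Z = fun x => ∑' n : ℕ,
      Complex.exp ((n : ℂ) * ((n : ℂ) - 1) * (lam : ℂ) / 2) /
        ((n.factorial : ℂ) * (lam : ℂ) ^ n) * x ^ n) :
    (∀ x : ℂ, Summable fun n : ℕ =>
      ‖Complex.exp ((n : ℂ) * ((n : ℂ) - 1) * (lam : ℂ) / 2) /
        ((n.factorial : ℂ) * (lam : ℂ) ^ n) * x ^ n‖) ∧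
    Differentiable ℂ Z ∧
    ∀ x : ℂ, (lam : ℂ) * x * deriv Z x = x * Z (Complex.exp (lam : ℂ) * x) := by
  have hl : (lam : ℂ) ≠ 0 := Complex.ofReal_ne_zero.mpr hlam.ne
  have hsum := summable_norm_hurwitzCoeff_mul_pow hlam.le
  have hterm (x : ℂ) (n : ℕ) : ((n : ℂ) + 1) * hurwitzCoeff lam (n + 1) * x ^ n =
      (lam : ℂ)⁻¹ * (hurwitzCoeff lam n * (Complex.exp lam * x) ^ n) := by
    rw [hurwitzCoeff_succ hlam.ne, mul_pow]
    ring
  have hZ' : Z = fun x => ∑' n, hurwitzCoeff lam n * x ^ n := hZ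
  have hderiv (x : ℂ) : HasDerivAt Z ((lam : ℂ)⁻¹ * Z (Complex.exp lam * x)) x := by
    have h := hasDerivAt_tsum_pow_of_summable (hurwitzCoeff lam) (fun y => by
      simp only [hterm, norm_mul (lam : ℂ)⁻¹]
      exact (hsum _).mul_left _) x
    simp only [hterm, tsum_mul_left] at h
    rwa [hZ']
  refine ⟨hsum, fun x => (hderiv x).differentiableAt, fun x => ?_⟩
  rw [(hderiv x).deriv]
  field_simp
end

section
/- Let a be an integer with a ≥ 1 and let λ be a real number with λ > 0. Then the series Z(x) = ∑_{n≥0} e^{−a n(n−1)λ/2 + nλ/2} / ∏_{j=1}^{n}(1 − e^{jλ}) · xⁿ converges absolutely for every x ∈ ℂ, so Z defines an entire function on ℂ, and this function satisfies Z(x) − Z(e^{λ}x) − e^{λ/2}·x·Z(e^{−aλ}x) = 0 for all x ∈ ℂ. -/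
open Filter Topology

/-- A power series that converges absolutely on all of `ℂ` defines an entire function. -/
theorem differentiable_tsum_mul_pow {c : ℕ → ℂ}
    (hc : ∀ x : ℂ, Summable fun n => ‖c n * x ^ n‖) :
    Differentiable ℂ fun x => ∑' n, c n * x ^ n := by
  intro x
  have hx : x ∈ Metric.ball (0 : ℂ) (‖x‖ + 1) := by simp
  refine (Complex.differentiableOn_tsum_of_summable_norm (hc ((‖x‖ + 1 : ℝ) : ℂ))
    (fun n => by fun_prop) Metric.isOpen_ball fun n w hw => ?_).differentiableAt
    (Metric.isOpen_ball.mem_nhds hx)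
  have hw' : ‖w‖ ≤ ‖x‖ + 1 := (mem_ball_zero_iff.mp hw).le
  rw [norm_mul, norm_mul, norm_pow, norm_pow, Complex.norm_real, Real.norm_of_nonneg (by positivity)]
  gcongr

/-- If the ratios of consecutive coefficients tend to `0`, the power series converges absolutely
everywhere. -/
theorem summable_norm_mul_pow_of_ratio_tendsto_zero {c r : ℕ → ℂ}
    (hcr : ∀ n, c (n + 1) = c n * r n) (hr : Tendsto r atTop (𝓝 0)) (x : ℂ) :
    Summable fun n => ‖c n * x ^ n‖ := by
  have hrx : Tendsto (fun n => ‖r n * x‖) atTop (𝓝 0) := by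
    simpa using (hr.mul_const x).norm
  refine summable_of_ratio_norm_eventually_le (r := 1 / 2) (by norm_num) ?_
  filter_upwards [hrx.eventually_le_const (by norm_num : (0 : ℝ) < 1 / 2)] with n hn
  rw [norm_norm, norm_norm, hcr,
    show c n * r n * x ^ (n + 1) = (r n * x) * (c n * x ^ n) by ring, norm_mul]
  gcongr

/-- If `c (n + 1) * (1 - q ^ (n + 1)) = s * t ^ n * c n`, then `f x = ∑ c n * x ^ n` satisfies
`f x - f (q * x) = s * x * f (t * x)`. -/
theorem tsum_mul_pow_sub_tsum_eq_of_recurrence {c : ℕ → ℂ} {q s t : ℂ}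
    (hc : ∀ x : ℂ, Summable fun n => ‖c n * x ^ n‖)
    (hrec : ∀ n, c (n + 1) * (1 - q ^ (n + 1)) = s * t ^ n * c n) (x : ℂ) :
    ∑' n, c n * x ^ n - ∑' n, c n * (q * x) ^ n = s * x * ∑' n, c n * (t * x) ^ n := by
  rw [← (hc x).of_norm.tsum_sub (hc (q * x)).of_norm,
    ((hc x).of_norm.sub (hc (q * x)).of_norm).tsum_eq_zero_add, ← tsum_mul_left]
  simp only [pow_zero, sub_self, zero_add]
  refine tsum_congr fun n => ?_
  linear_combination x ^ (n + 1) * hrec n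

theorem exp_sub_one_le_norm_one_sub_exp {lam : ℝ} (hlam : 0 < lam) (n : ℕ) :
    Real.exp lam - 1 ≤ ‖1 - Complex.exp (((n : ℂ) + 1) * (lam : ℂ))‖ := by
  rw [show (1 - Complex.exp (((n : ℂ) + 1) * (lam : ℂ))) =
    ((1 - Real.exp ((n + 1) * lam) : ℝ) : ℂ) by push_cast; rfl, Complex.norm_real, norm_sub_rev]
  refine le_trans ?_ (Real.le_norm_self _)
  have : lam ≤ (n + 1) * lam := by nlinarith [(n.cast_nonneg : (0 : ℝ) ≤ n)]
  gcongr

theorem one_sub_exp_ne_zero {lam : ℝ} (hlam : 0 < lam) (n : ℕ) :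
    1 - Complex.exp (((n : ℂ) + 1) * (lam : ℂ)) ≠ 0 :=
  norm_pos_iff.mp <| (sub_pos.mpr (Real.one_lt_exp_iff.mpr hlam)).trans_le
    (exp_sub_one_le_norm_one_sub_exp hlam n)

theorem tendsto_framed_vertex_ratio {a : ℤ} (ha : 1 ≤ a) {lam : ℝ} (hlam : 0 < lam) :
    Tendsto (fun n : ℕ => Complex.exp ((lam : ℂ) / 2) * Complex.exp (-(a : ℂ) * (lam : ℂ)) ^ n /
      (1 - Complex.exp (((n : ℂ) + 1) * (lam : ℂ)))) atTop (𝓝 0) := by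
  have ht : ‖Complex.exp (-(a : ℂ) * (lam : ℂ))‖ < 1 := by
    have ha' : (0 : ℝ) < a := by exact_mod_cast ha
    rw [Complex.norm_exp, Real.exp_lt_one_iff]
    simpa using mul_pos ha' hlam
  have hpos : 0 < Real.exp lam - 1 := sub_pos.mpr (Real.one_lt_exp_iff.mpr hlam)
  refine squeeze_zero_norm (a := fun n : ℕ => ‖Complex.exp ((lam : ℂ) / 2)‖ *
    ‖Complex.exp (-(a : ℂ) * (lam : ℂ))‖ ^ n / (Real.exp lam - 1)) (fun n => ?_) ?_
  · rw [norm_div, norm_mul, norm_pow]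
    gcongr
    exact exp_sub_one_le_norm_one_sub_exp hlam n
  · simpa using ((tendsto_pow_atTop_nhds_zero_of_lt_one (norm_nonneg _) ht).const_mul
      ‖Complex.exp ((lam : ℂ) / 2)‖).div_const (Real.exp lam - 1)

/-- For an integer framing `a ≥ 1` and real `λ > 0`, the framed `ℂ³` partition function
`Z(x) = ∑_{n≥0} e^{−an(n−1)λ/2+nλ/2}/∏_{j=1}^n(1−e^{jλ}) · xⁿ` converges absolutely for
every `x ∈ ℂ`, defines an entire function, and satisfies the quantum mirror curve equation
`Z(x) − Z(e^λ x) − e^{λ/2}·x·Z(e^{−aλ} x) = 0`. -/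
theorem quantum_mirror_curve_C3_analytic (a : ℤ) (ha : 1 ≤ a) (lam : ℝ) (hlam : 0 < lam)
    (Z : ℂ → ℂ)
    (hZ : Z = fun x => ∑' n : ℕ,
      Complex.exp (-(a : ℂ) * (n : ℂ) * ((n : ℂ) - 1) * (lam : ℂ) / 2 +
          (n : ℂ) * (lam : ℂ) / 2) /
        (∏ j ∈ Finset.range n, (1 - Complex.exp (((j : ℂ) + 1) * (lam : ℂ)))) * x ^ n) :
    (∀ x : ℂ, Summable fun n : ℕ =>
      ‖Complex.exp (-(a : ℂ) * (n : ℂ) * ((n : ℂ) - 1) * (lam : ℂ) / 2 +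
          (n : ℂ) * (lam : ℂ) / 2) /
        (∏ j ∈ Finset.range n, (1 - Complex.exp (((j : ℂ) + 1) * (lam : ℂ)))) * x ^ n‖) ∧
    Differentiable ℂ Z ∧
    ∀ x : ℂ, Z x - Z (Complex.exp (lam : ℂ) * x) -
      Complex.exp ((lam : ℂ) / 2) * x * Z (Complex.exp (-(a : ℂ) * (lam : ℂ)) * x) = 0 := by
  set c : ℕ → ℂ := fun n => Complex.exp (-(a : ℂ) * (n : ℂ) * ((n : ℂ) - 1) * (lam : ℂ) / 2 +
      (n : ℂ) * (lam : ℂ) / 2) /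
    (∏ j ∈ Finset.range n, (1 - Complex.exp (((j : ℂ) + 1) * (lam : ℂ)))) with hc
  have hratio (n : ℕ) : c (n + 1) = c n * (Complex.exp ((lam : ℂ) / 2) *
      Complex.exp (-(a : ℂ) * (lam : ℂ)) ^ n /
        (1 - Complex.exp (((n : ℂ) + 1) * (lam : ℂ)))) := by
    simp only [hc]
    rw [Finset.prod_range_succ, div_mul_div_comm, ← Complex.exp_nat_mul, ← Complex.exp_add,
      ← Complex.exp_add]
    congr 2
    push_cast
    ring
  have hsum : ∀ x : ℂ, Summable fun n => ‖c n * x ^ n‖ :=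
    summable_norm_mul_pow_of_ratio_tendsto_zero hratio (tendsto_framed_vertex_ratio ha hlam)
  have hrec (n : ℕ) : c (n + 1) * (1 - Complex.exp (lam : ℂ) ^ (n + 1)) =
      Complex.exp ((lam : ℂ) / 2) * Complex.exp (-(a : ℂ) * (lam : ℂ)) ^ n * c n := by
    rw [hratio, ← Complex.exp_nat_mul _ (n + 1), Nat.cast_succ, mul_assoc,
      div_mul_cancel₀ _ (one_sub_exp_ne_zero hlam n), mul_comm]
  subst hZ
  exact ⟨hsum, differentiable_tsum_mul_pow hsum, fun x =>
    sub_eq_zero.mpr (tsum_mul_pow_sub_tsum_eq_of_recurrence hsum hrec x)⟩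
end
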